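/- arXiv:1912.11265 — 6 statements merged into one kernel-verified Lean document; each statement's English description precedes it below -/
import Mathlib

section
/- Let n ≥ 1 and let e : B ≃ S_n be any bijection of the two index sets. Then the square of the determinant of the n! × n! square matrix (P_{e(a), a'})_{a, a' ∈ B} equals Δ^{n!}; in other words, the determinant of P equals ±Δ^{n!/2}. -/
/-!
Work in ℤ[x_1, …, x_n].  `Δ` is the Vandermonde product ∏_{i<j} (x_i − x_j),
`B` is the set of exponent tuples `a` with `0 ≤ a_i ≤ i − 1` (0-indexed: `a i ≤ i`),
`xB a` is the monomial `x^a`, and `P` is the n! × n! matrix with rows indexed by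
permutations σ, columns indexed by `B`, and entries `P σ a = σ(x^a)`.
-/

open MvPolynomial

/-- The index set `B`: tuples `(a_1, …, a_n)` with `0 ≤ a_i ≤ i - 1` (in 1-indexed
notation), i.e. `a i ≤ i` in 0-indexed notation.  It has cardinality `n!`. -/
abbrev TupleB (n : ℕ) : Type := ∀ i : Fin n, Fin (i.1 + 1)

/-- The monomial `x_a = x_1^{a_1} ⋯ x_n^{a_n}` for `a ∈ B`. -/
noncomputable def xB {n : ℕ} (a : TupleB n) : MvPolynomial (Fin n) ℤ :=
  ∏ i : Fin n, (X i : MvPolynomial (Fin n) ℤ) ^ (a i : ℕ)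

/-- `Δ = ∏_{1 ≤ i < j ≤ n} (x_i − x_j)`. -/
noncomputable def Vdm (n : ℕ) : MvPolynomial (Fin n) ℤ :=
  ∏ p ∈ Finset.univ.filter (fun p : Fin n × Fin n => p.1 < p.2), (X p.1 - X p.2)

/-- The matrix `P` with `P_{σ, a} = σ(x_a)`, the permutation σ acting by permuting
the variables. -/
noncomputable def matP (n : ℕ) :
    Matrix (Equiv.Perm (Fin n)) (TupleB n) (MvPolynomial (Fin n) ℤ) :=
  fun σ a => rename σ (xB a)

open Kronecker Matrix

section

variable {R : Type*} [CommRing R]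

/-- The product `∏_{i < j} (v i - v j)`. -/
def vdmProd {n : ℕ} (v : Fin n → R) : R :=
  ∏ i, ∏ j, if i < j then v i - v j else 1

/-- The specialisation of `matP` at a family `v` of ring elements. -/
def evalMatP {n : ℕ} (v : Fin n → R) : Matrix (Equiv.Perm (Fin n)) (TupleB n) R :=
  fun σ a => ∏ i, v (σ i) ^ (a i : ℕ)

theorem det_submatrix_equiv_sq {ι κ : Type*} [Fintype ι] [DecidableEq ι] [Fintype κ]
    [DecidableEq κ] (A : Matrix κ κ R) (e f : ι ≃ κ) :
    (A.submatrix e f).det ^ 2 = A.det ^ 2 := by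
  have h : A.submatrix e f = (A.submatrix f f).submatrix (e.trans f.symm) id := by
    ext i j
    simp
  rw [h, det_permute, det_submatrix_equiv_self, mul_pow]
  rcases Int.units_eq_one_or (Equiv.Perm.sign (e.trans f.symm)) with h | h <;> simp [h]

theorem det_submatrix_sq_eq {ι κ α β : Type*} [Fintype ι] [DecidableEq ι] [Fintype κ]
    [DecidableEq κ] (M : Matrix α β R) (e : ι ≃ α) (f : ι ≃ β) (e' : κ ≃ α) (f' : κ ≃ β) :
    (M.submatrix e f).det ^ 2 = (M.submatrix e' f').det ^ 2 := by
  rw [← det_submatrix_equiv_sq (M.submatrix e' f') (e.trans e'.symm) (f.trans f'.symm)]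
  congr 2
  ext i j
  simp

theorem vdmProd_eq_succAbove {n : ℕ} (v : Fin (n + 1) → R) (j : Fin (n + 1)) :
    vdmProd v = vdmProd (v ∘ j.succAbove) * (∏ k, if j < k then v j - v k else 1) *
      ∏ i, if i < j then v i - v j else 1 := by
  have hrow (i : Fin n) : (∏ k, if j.succAbove i < k then v (j.succAbove i) - v k else 1) =
      (if j.succAbove i < j then v (j.succAbove i) - v j else 1) *
        ∏ k, if i < k then v (j.succAbove i) - v (j.succAbove k) else 1 := by
    rw [Fin.prod_univ_succAbove _ j]
    simp only [Fin.succAbove_lt_succAbove_iff]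
  rw [vdmProd, Fin.prod_univ_succAbove _ j, Finset.prod_congr rfl fun i _ => hrow i,
    Finset.prod_mul_distrib, Fin.prod_univ_succAbove (fun i => if i < j then v i - v j else 1) j]
  simp only [vdmProd, Function.comp_apply, lt_irrefl, if_false, one_mul]
  ring

theorem prod_vdmProd_succAbove_mul_sq {n : ℕ} (v : Fin (n + 1) → R) :
    (∏ j : Fin (n + 1), vdmProd (v ∘ j.succAbove)) * vdmProd v ^ 2 = vdmProd v ^ (n + 1) := by
  have h : ∏ _j : Fin (n + 1), vdmProd v = vdmProd v ^ (n + 1) := by simp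
  rw [← h, Finset.prod_congr rfl fun j _ => vdmProd_eq_succAbove v j,
    Finset.prod_mul_distrib, Finset.prod_mul_distrib,
    Finset.prod_comm (f := fun j i => if i < j then v i - v j else 1)]
  simp only [vdmProd]
  ring

theorem det_vandermonde_sq {n : ℕ} (v : Fin n → R) :
    (vandermonde v).det ^ 2 = vdmProd v ^ 2 := by
  simp only [det_vandermonde, vdmProd, ← Finset.prod_pow]
  refine Finset.prod_congr rfl fun i _ => ?_
  simp only [ite_pow, one_pow, ← Finset.prod_filter, Finset.filter_lt_eq_Ioi]
  exact Finset.prod_congr rfl fun j _ => by ring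

/-- The permutation of `Fin (n + 1)` sending the last element to `j` and acting as `τ` on the
remaining elements, once the complement of `j` is identified with `Fin n`. -/
def permSnoc {n : ℕ} (p : Equiv.Perm (Fin n) × Fin (n + 1)) : Equiv.Perm (Fin (n + 1)) :=
  finSuccEquivLast.trans ((Equiv.optionCongr p.1).trans (finSuccEquiv' p.2).symm)

theorem permSnoc_last {n : ℕ} (p : Equiv.Perm (Fin n) × Fin (n + 1)) :
    permSnoc p (Fin.last n) = p.2 := by
  simp [permSnoc]

theorem permSnoc_castSucc {n : ℕ} (p : Equiv.Perm (Fin n) × Fin (n + 1)) (i : Fin n) :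
    permSnoc p i.castSucc = p.2.succAbove (p.1 i) := by
  simp [permSnoc]

theorem permSnoc_bijective (n : ℕ) : Function.Bijective (permSnoc (n := n)) := by
  rw [Fintype.bijective_iff_injective_and_card]
  constructor
  · rintro ⟨τ, j⟩ ⟨τ', j'⟩ h
    have hj : j = j' := by
      simpa only [permSnoc_last] using congrArg (fun σ => σ (Fin.last n)) h
    subst hj
    have hτ : τ = τ' := by
      ext1 i
      simpa only [permSnoc_castSucc, Fin.succAbove_right_inj] using
        congrArg (fun σ => σ i.castSucc) h
    rw [hτ]
  · simp [Fintype.card_perm, Nat.factorial_succ, mul_comm]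

theorem card_tupleB (n : ℕ) : Fintype.card (TupleB n) = n.factorial := by
  simp [Fintype.card_pi, Fin.prod_univ_eq_prod_range (fun i => i + 1) n,
    Finset.prod_range_add_one_eq_factorial]

/-- Appending a last exponent to a tuple. -/
def tupleSnoc (n : ℕ) : TupleB n × Fin (n + 1) ≃ TupleB (n + 1) :=
  (Equiv.prodComm _ _).trans (Fin.snocEquiv fun i : Fin (n + 1) => Fin (i.1 + 1))

theorem tupleSnoc_last {n : ℕ} (p : TupleB n × Fin (n + 1)) :
    tupleSnoc n p (Fin.last n) = p.2 := by
  simp [tupleSnoc, Fin.snocEquiv]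

theorem tupleSnoc_castSucc {n : ℕ} (p : TupleB n × Fin (n + 1)) (i : Fin n) :
    tupleSnoc n p i.castSucc = p.1 i := by
  simp [tupleSnoc, Fin.snocEquiv]

theorem evalMatP_permSnoc_tupleSnoc {n : ℕ} (v : Fin (n + 1) → R)
    (p : Equiv.Perm (Fin n) × Fin (n + 1)) (q : TupleB n × Fin (n + 1)) :
    evalMatP v (permSnoc p) (tupleSnoc n q) =
      evalMatP (v ∘ p.2.succAbove) p.1 q.1 * v p.2 ^ (q.2 : ℕ) := by
  rw [evalMatP, Fin.prod_univ_castSucc, permSnoc_last, tupleSnoc_last]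
  simp only [permSnoc_castSucc, tupleSnoc_castSucc, evalMatP, Function.comp_apply]

theorem evalMatP_submatrix_eq_mul {n : ℕ} (v : Fin (n + 1) → R)
    (e : TupleB n ≃ Equiv.Perm (Fin n)) :
    (evalMatP v).submatrix (fun p : TupleB n × Fin (n + 1) => permSnoc (e p.1, p.2))
        (tupleSnoc n) =
      blockDiagonal (fun j : Fin (n + 1) => (evalMatP (v ∘ j.succAbove)).submatrix e id) *
        ((1 : Matrix (TupleB n) (TupleB n) R) ⊗ₖ vandermonde v) := by
  ext ⟨c, j⟩ ⟨a, k⟩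
  rw [submatrix_apply, evalMatP_permSnoc_tupleSnoc]
  simp [mul_apply, Fintype.sum_prod_type, one_apply, blockDiagonal_apply, kroneckerMap_apply,
    vandermonde_apply]

theorem det_evalMatP_sq {n : ℕ} (v : Fin n → R) (e : TupleB n ≃ Equiv.Perm (Fin n)) :
    ((evalMatP v).submatrix e id).det ^ 2 = vdmProd v ^ n.factorial := by
  induction n with
  | zero => simp [det_unique, evalMatP, vdmProd]
  | succ n ih =>
    have e' : TupleB n ≃ Equiv.Perm (Fin n) :=
      Fintype.equivOfCardEq (by rw [card_tupleB, Fintype.card_perm, Fintype.card_fin])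
    have h := det_submatrix_sq_eq (evalMatP v) e (Equiv.refl _)
      ((e'.prodCongr (Equiv.refl _)).trans (Equiv.ofBijective _ (permSnoc_bijective n)))
      (tupleSnoc n)
    refine h.trans ?_
    change ((evalMatP v).submatrix (fun p : TupleB n × Fin (n + 1) => permSnoc (e' p.1, p.2))
      (tupleSnoc n)).det ^ 2 = _
    rw [evalMatP_submatrix_eq_mul, det_mul, det_blockDiagonal, det_kronecker, det_one, one_pow,
      one_mul, card_tupleB, mul_pow, ← Finset.prod_pow,
      Finset.prod_congr rfl fun j _ => ih (v ∘ j.succAbove) e', pow_right_comm,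
      det_vandermonde_sq, Finset.prod_pow, ← mul_pow, prod_vdmProd_succAbove_mul_sq, ← pow_mul,
      Nat.factorial_succ]

end

theorem vdm_eq_vdmProd (n : ℕ) :
    Vdm n = vdmProd (X : Fin n → MvPolynomial (Fin n) ℤ) := by
  rw [Vdm, vdmProd, Finset.prod_filter, Fintype.prod_prod_type]

theorem matP_eq_evalMatP (n : ℕ) :
    matP n = evalMatP (X : Fin n → MvPolynomial (Fin n) ℤ) := by
  ext1 σ a
  simp [matP, evalMatP, xB]

/-- for any bijection `e : B ≃ S_n`, the square of the determinant of the
`n! × n!` square matrix `(P_{e(a), a'})_{a, a' ∈ B}` equals `Δ^{n!}`. -/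
theorem det_sq_eq_delta_pow_factorial (n : ℕ) (hn : 1 ≤ n)
    (e : TupleB n ≃ Equiv.Perm (Fin n)) :
    (Matrix.det (fun a a' : TupleB n => matP n (e a) a')) ^ 2 = Vdm n ^ (Nat.factorial n) := by
  rw [vdm_eq_vdmProd, matP_eq_evalMatP]
  exact det_evalMatP_sq _ e
end

section
/- Let k be a commutative ring, let n ≥ 1, and let G = ℤ^n ⋊ S_n be the semidirect product of the free abelian group ℤ^n (written multiplicatively) by the symmetric group S_n acting by permuting coordinates. In the group algebra k[G], write x_c for the group element corresponding to c ∈ ℤ^n, set Δ = ∏_{1 ≤ i < j ≤ n} (x_{ε_i} − x_{ε_j}) where ε_1, …, ε_n are the standard basis vectors of ℤ^n, and set e = Σ_{σ ∈ S_n} σ. Let M be a k[G]-module and let eM = {e·m : m ∈ M}, a k-submodule of M. Then the k-linear map f : ⊕_{a ∈ B} eM → M defined by f((m_a)_{a ∈ B}) = Σ_{a ∈ B} x_a · m_a has kernel and cokernel annihilated by Δ^{n!}: that is, for every element (m_a) of the kernel of f one has Δ^{n!}·m_a = 0 for all a ∈ B, and for every m ∈ M one has Δ^{n!}·m ∈ image(f).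 -/
/-!
STATEMENT 3.  `G = ℤ^n ⋊ S_n` (extended affine Weyl group), group algebra `k[G]`,
`Δ = ∏_{i<j} (x_{ε_i} − x_{ε_j})`, `e = Σ_{σ ∈ S_n} σ`, and the map
`f : ⊕_{a ∈ B} eM → M`, `(m_a) ↦ Σ_a x_a · m_a` has kernel and cokernel annihilated
by `Δ^{n!}`.
-/

open MonoidAlgebra

/-- The action of `S_n` on `ℤ^n` (written multiplicatively) permuting the coordinates. -/
def permMulEquiv {n : ℕ} (σ : Equiv.Perm (Fin n)) :
    Multiplicative (Fin n → ℤ) ≃* Multiplicative (Fin n → ℤ) where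
  toFun c := Multiplicative.ofAdd (Multiplicative.toAdd c ∘ ⇑σ.symm)
  invFun c := Multiplicative.ofAdd (Multiplicative.toAdd c ∘ ⇑σ)
  left_inv c := by
    show Multiplicative.ofAdd ((Multiplicative.toAdd c ∘ ⇑σ.symm) ∘ ⇑σ) = c
    simp [Function.comp_def]
  right_inv c := by
    show Multiplicative.ofAdd ((Multiplicative.toAdd c ∘ ⇑σ) ∘ ⇑σ.symm) = c
    simp [Function.comp_def]
  map_mul' c d := rfl

/-- `S_n → Aut(ℤ^n)`, permutation of coordinates. -/
def permHom (n : ℕ) : Equiv.Perm (Fin n) →* MulAut (Multiplicative (Fin n → ℤ)) where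
  toFun := permMulEquiv
  map_one' := rfl
  map_mul' σ τ := rfl

/-- The semidirect product `G = ℤ^n ⋊ S_n`. -/
abbrev WeylGrp (n : ℕ) : Type := Multiplicative (Fin n → ℤ) ⋊[permHom n] Equiv.Perm (Fin n)

/-- The group element `x_c ∈ G` for `c ∈ ℤ^n`. -/
def xElt {n : ℕ} (c : Fin n → ℤ) : WeylGrp n :=
  SemidirectProduct.inl (Multiplicative.ofAdd c)

/-- `x_a ∈ k[G]` for an exponent tuple `a ∈ B`. -/
noncomputable def xA (k : Type*) [CommRing k] {n : ℕ} (a : TupleB n) :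
    MonoidAlgebra k (WeylGrp n) :=
  MonoidAlgebra.of k (WeylGrp n) (xElt (fun i => ((a i : ℕ) : ℤ)))

/-- `Δ = ∏_{1 ≤ i < j ≤ n} (x_{ε_i} − x_{ε_j})`, computed in the commutative group
algebra `k[ℤ^n]` and pushed forward to `k[G]`. -/
noncomputable def DeltaElt (k : Type*) [CommRing k] (n : ℕ) :
    MonoidAlgebra k (WeylGrp n) :=
  MonoidAlgebra.mapDomainRingHom k (SemidirectProduct.inl :
      Multiplicative (Fin n → ℤ) →* WeylGrp n)
    (∏ p ∈ Finset.univ.filter (fun p : Fin n × Fin n => p.1 < p.2),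
      (MonoidAlgebra.of k (Multiplicative (Fin n → ℤ))
          (Multiplicative.ofAdd (Pi.single p.1 (1 : ℤ))) -
        MonoidAlgebra.of k (Multiplicative (Fin n → ℤ))
          (Multiplicative.ofAdd (Pi.single p.2 (1 : ℤ)))))

/-- `e = Σ_{σ ∈ S_n} σ ∈ k[G]`. -/
noncomputable def eElt (k : Type*) [CommRing k] (n : ℕ) : MonoidAlgebra k (WeylGrp n) :=
  ∑ σ : Equiv.Perm (Fin n), MonoidAlgebra.of k (WeylGrp n) (SemidirectProduct.inr σ)

namespace WeylOldforms

open MvPolynomial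

variable {n : ℕ}

/-- The monomial `X^a` with exponents `a ∈ B`. -/
noncomputable def mon (a : TupleB n) : MvPolynomial (Fin n) ℤ :=
  ∏ i, X i ^ (a i : ℕ)

/-- The polynomial `∏_{i < j} (X_i - X_j)`, written as a Vandermonde determinant. -/
noncomputable def discr (n : ℕ) : MvPolynomial (Fin n) ℤ :=
  (Matrix.vandermonde fun i : Fin n => -(X i : MvPolynomial (Fin n) ℤ)).det

/-- The polynomial `∏_{j < i} (X_j - T)` in one variable `T`. -/
noncomputable def factorPoly (i : Fin n) : Polynomial (MvPolynomial (Fin n) ℤ) :=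
  ∏ j ∈ Finset.Iio i, (Polynomial.C (X j) - Polynomial.X)

/-- The coefficient of `T^a` in `∏_i ∏_{j < i} (X_j - T_i)`. -/
noncomputable def dualCoeff (a : TupleB n) : MvPolynomial (Fin n) ℤ :=
  ∏ i, (factorPoly i).coeff (a i)

theorem discr_eq_prod (n : ℕ) :
    discr n = ∏ i : Fin n, ∏ j ∈ Finset.Ioi i, (X i - X j) := by
  rw [discr, Matrix.det_vandermonde]
  refine Finset.prod_congr rfl fun i _ => Finset.prod_congr rfl fun j _ => ?_
  ring

theorem discr_ne_zero (n : ℕ) : discr n ≠ 0 := by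
  rw [discr, Matrix.det_vandermonde_ne_zero_iff]
  exact neg_injective.comp (X_injective (R := ℤ))

theorem rename_discr (σ : Equiv.Perm (Fin n)) :
    rename σ (discr n) = ((Equiv.Perm.sign σ : ℤ) : MvPolynomial (Fin n) ℤ) * discr n := by
  rw [discr, ← Matrix.det_permute, AlgHom.map_det]
  congr 1
  ext1 i j
  simp [Matrix.vandermonde_apply]

theorem natDegree_factorPoly_lt (i : Fin n) : (factorPoly i).natDegree < i.1 + 1 := by
  refine Nat.lt_succ_of_le ((Polynomial.natDegree_prod_le _ _).trans ?_)
  refine (Finset.sum_le_card_nsmul _ _ 1 fun j _ => ?_).trans (by simp)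
  exact (Polynomial.natDegree_sub_le _ _).trans (by simp)

theorem sum_rename_mon_mul_dualCoeff_eq_prod (τ : Equiv.Perm (Fin n)) :
    ∑ a : TupleB n, rename τ (mon a) * dualCoeff a =
      ∏ i : Fin n, ∏ j ∈ Finset.Iio i, (X j - X (τ i)) := by
  have h (i : Fin n) : ∏ j ∈ Finset.Iio i, (X j - X (τ i) : MvPolynomial (Fin n) ℤ) =
      ∑ l : Fin (i.1 + 1), X (τ i) ^ (l : ℕ) * (factorPoly i).coeff l := by
    have := Polynomial.eval_eq_sum_range' (natDegree_factorPoly_lt i)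
      (X (τ i) : MvPolynomial (Fin n) ℤ)
    rw [Finset.sum_range] at this
    simpa [factorPoly, Polynomial.eval_prod, mul_comm] using this
  simp_rw [h, Finset.prod_univ_sum, Fintype.piFinset_univ, Finset.prod_mul_distrib]
  simp [mon, dualCoeff]

theorem exists_apply_lt {τ : Equiv.Perm (Fin n)} (h : τ ≠ 1) : ∃ i, τ i < i := by
  by_contra! hle
  have hsum : ∑ i : Fin n, (i : ℕ) = ∑ i, (τ i : ℕ) := (Equiv.sum_comp τ fun i => (i : ℕ)).symm
  have heq := (Finset.sum_eq_sum_iff_of_le fun i _ => Fin.le_def.1 (hle i)).1 hsum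
  exact h (Equiv.ext fun i => (Fin.ext (heq i (Finset.mem_univ i))).symm)

theorem sum_rename_mon_mul_dualCoeff (τ : Equiv.Perm (Fin n)) :
    ∑ a : TupleB n, rename τ (mon a) * dualCoeff a = if τ = 1 then discr n else 0 := by
  rw [sum_rename_mon_mul_dualCoeff_eq_prod]
  split_ifs with h
  · subst h
    rw [discr_eq_prod]
    exact Finset.prod_comm' (by simp)
  · obtain ⟨i, hi⟩ := exists_apply_lt h
    exact Finset.prod_eq_zero (Finset.mem_univ i)
      (Finset.prod_eq_zero (Finset.mem_Iio.2 hi) (sub_self _))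

theorem sum_mon_mul_rename_dualCoeff (σ : Equiv.Perm (Fin n)) :
    ∑ a : TupleB n, mon a * rename σ (dualCoeff a) = if σ = 1 then discr n else 0 := by
  have h := congrArg (rename σ) (sum_rename_mon_mul_dualCoeff σ⁻¹)
  simp only [map_sum, map_mul, rename_rename, ← Equiv.Perm.coe_mul, mul_inv_cancel,
    Equiv.Perm.coe_one, rename_id_apply, inv_eq_one] at h
  rw [h]
  split_ifs with hσ
  · simp [hσ]
  · simp

/-- The matrix of all `σ(X^a)`. -/
noncomputable def monMatrix (n : ℕ) :
    Matrix (Equiv.Perm (Fin n)) (TupleB n) (MvPolynomial (Fin n) ℤ) :=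
  Matrix.of fun σ a => rename σ (mon a)

/-- The matrix inverse to `monMatrix` up to the factor `discr`. -/
noncomputable def dualMatrix (n : ℕ) :
    Matrix (TupleB n) (Equiv.Perm (Fin n)) (MvPolynomial (Fin n) ℤ) :=
  Matrix.of fun a σ => ((Equiv.Perm.sign σ : ℤ) : MvPolynomial (Fin n) ℤ) * rename σ (dualCoeff a)

theorem monMatrix_mul_dualMatrix (n : ℕ) : monMatrix n * dualMatrix n = discr n • 1 := by
  ext1 τ σ
  have h := congrArg (rename σ) (sum_rename_mon_mul_dualCoeff (σ⁻¹ * τ))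
  simp only [map_sum, map_mul, rename_rename, ← Equiv.Perm.coe_mul, mul_inv_cancel_left] at h
  simp only [Matrix.mul_apply, monMatrix, dualMatrix, Matrix.of_apply, mul_left_comm,
    ← Finset.mul_sum, h, inv_mul_eq_one, Matrix.smul_apply, Matrix.one_apply, eq_comm (a := σ)]
  split_ifs
  · rw [rename_discr, ← mul_assoc, ← Int.cast_mul]
    simp [← Units.val_mul]
  · simp

theorem card_tupleB (n : ℕ) : Fintype.card (TupleB n) = n.factorial := by
  simp [Fin.prod_univ_eq_prod_range (fun i => i + 1) n, Finset.prod_range_add_one_eq_factorial]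

theorem dualMatrix_mul_monMatrix (n : ℕ) : dualMatrix n * monMatrix n = discr n • 1 := by
  let ι := algebraMap (MvPolynomial (Fin n) ℤ) (FractionRing (MvPolynomial (Fin n) ℤ))
  have hι : Function.Injective ι := IsFractionRing.injective _ _
  have hd : ι (discr n) ≠ 0 := by simpa using hι.ne (discr_ne_zero n)
  have hmap {m : Type} [Fintype m] [DecidableEq m] :
      (discr n • (1 : Matrix m m (MvPolynomial (Fin n) ℤ))).map ι = ι (discr n) • 1 := by
    rw [Matrix.map_smul' _ _ _ (map_mul ι)]
    simp
  have h := congrArg (fun A => A.map ι) (monMatrix_mul_dualMatrix n)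
  simp only [Matrix.map_mul, hmap] at h
  have hone : (monMatrix n).map ι * ((ι (discr n))⁻¹ • (dualMatrix n).map ι) = 1 := by
    rw [Matrix.mul_smul, h, smul_smul, inv_mul_cancel₀ hd, one_smul]
  have hcard : Fintype.card (Equiv.Perm (Fin n)) = Fintype.card (TupleB n) := by
    rw [card_tupleB, Fintype.card_perm, Fintype.card_fin]
  rw [Matrix.mul_eq_one_comm_of_card_eq _ _ _ hcard, Matrix.smul_mul, inv_smul_eq_iff₀ hd] at hone
  apply Matrix.map_injective hι
  simp only [Matrix.map_mul, hmap, hone]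

variable (k : Type*) [CommRing k]

/-- The ring homomorphism `ℤ[X_1, …, X_n] → k[G]` sending `X_i` to `x_{ε_i}`. -/
noncomputable def polyHom (n : ℕ) : MvPolynomial (Fin n) ℤ →+* MonoidAlgebra k (WeylGrp n) :=
  (MonoidAlgebra.mapDomainRingHom k (SemidirectProduct.inl :
      Multiplicative (Fin n → ℤ) →* WeylGrp n)).comp
    (eval₂Hom (Int.castRingHom _) fun i =>
      MonoidAlgebra.of k _ (Multiplicative.ofAdd (Pi.single i (1 : ℤ))))

/-- A permutation as an element of `k[G]`. -/
noncomputable def permElt (σ : Equiv.Perm (Fin n)) : MonoidAlgebra k (WeylGrp n) :=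
  MonoidAlgebra.of k (WeylGrp n) (SemidirectProduct.inr σ)

theorem polyHom_X (i : Fin n) :
    polyHom k n (X i) = MonoidAlgebra.of k (WeylGrp n) (xElt (Pi.single i 1)) := by
  simp [polyHom, xElt]

theorem polyHom_discr (n : ℕ) : polyHom k n (discr n) = DeltaElt k n := by
  rw [discr_eq_prod, DeltaElt, polyHom, RingHom.comp_apply]
  congr 1
  simp only [map_prod, map_sub, coe_eval₂Hom, eval₂_X]
  rw [Finset.prod_sigma']
  refine Finset.prod_bij' (fun p _ => (p.1, p.2)) (fun p _ => ⟨p.1, p.2⟩) ?_ ?_ ?_ ?_ ?_ <;> simp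

theorem polyHom_mon (a : TupleB n) : polyHom k n (mon a) = xA k a := by
  have h : (fun i => ((a i : ℕ) : ℤ)) = ∑ i, (a i : ℕ) • (Pi.single i 1 : Fin n → ℤ) := by
    ext j
    simp [Finset.sum_apply, Pi.single_apply]
  rw [mon, polyHom, RingHom.comp_apply, xA, xElt, h]
  simp only [map_prod, map_pow, coe_eval₂Hom, eval₂_X]
  simp only [← map_pow, ← map_prod, ← ofAdd_nsmul, ← ofAdd_sum]
  simp

theorem permElt_mul_polyHom (σ : Equiv.Perm (Fin n)) (p : MvPolynomial (Fin n) ℤ) :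
    permElt k σ * polyHom k n p = polyHom k n (rename σ p) * permElt k σ := by
  induction p using MvPolynomial.induction_on with
  | C z => simp [Int.cast_comm]
  | add p q hp hq => simp only [map_add, mul_add, add_mul, hp, hq]
  | mul_X p i hp =>
    rw [map_mul, ← mul_assoc, hp, mul_assoc, map_mul, map_mul, mul_assoc, rename_X]
    congr 1
    rw [polyHom_X, polyHom_X, permElt, ← map_mul, ← map_mul]
    congr 1
    have h : Multiplicative.ofAdd (Pi.single (σ i) (1 : ℤ)) =
        permHom n σ (Multiplicative.ofAdd (Pi.single i 1)) := by
      refine congrArg Multiplicative.ofAdd (funext fun j => ?_)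
      change (Pi.single (σ i) 1 : Fin n → ℤ) j = (Pi.single i 1 : Fin n → ℤ) (σ.symm j)
      simp [Pi.single_apply, Equiv.symm_apply_eq]
    rw [xElt, xElt, h, SemidirectProduct.inl_aut]
    simp

theorem permElt_mul_eElt (σ : Equiv.Perm (Fin n)) : permElt k σ * eElt k n = eElt k n := by
  simp only [eElt, permElt, Finset.mul_sum, ← map_mul]
  exact Equiv.sum_comp (Equiv.mulLeft σ)
    fun τ => MonoidAlgebra.of k (WeylGrp n) (SemidirectProduct.inr τ)

theorem polyHom_discr_smul_eq_zero {M : Type*} [AddCommGroup M]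
    [Module (MonoidAlgebra k (WeylGrp n)) M] {m : TupleB n → M}
    (hinv : ∀ (σ : Equiv.Perm (Fin n)) a, permElt k σ • m a = m a)
    (hm : ∑ a, xA k a • m a = 0) (a : TupleB n) :
    polyHom k n (discr n) • m a = 0 := by
  have hrow (σ : Equiv.Perm (Fin n)) : ∑ b, polyHom k n (monMatrix n σ b) • m b = 0 := by
    have h := congrArg (permElt k σ • ·) hm
    simpa only [Finset.smul_sum, smul_zero, ← polyHom_mon, smul_smul, permElt_mul_polyHom, mul_smul,
      hinv, monMatrix, Matrix.of_apply] using h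
  calc polyHom k n (discr n) • m a
      = ∑ b, polyHom k n ((dualMatrix n * monMatrix n) a b) • m b := by
        rw [dualMatrix_mul_monMatrix]
        simp [Matrix.one_apply, ite_smul, apply_ite (polyHom k n)]
    _ = ∑ σ, polyHom k n (dualMatrix n a σ) • ∑ b, polyHom k n (monMatrix n σ b) • m b := by
        simp only [Matrix.mul_apply, map_sum, map_mul, Finset.sum_smul, Finset.smul_sum, mul_smul]
        exact Finset.sum_comm
    _ = 0 := by simp [hrow]

theorem sum_xA_mul_eElt_mul_polyHom (n : ℕ) :
    ∑ a : TupleB n, xA k a * (eElt k n * polyHom k n (dualCoeff a)) = polyHom k n (discr n) := by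
  calc ∑ a : TupleB n, xA k a * (eElt k n * polyHom k n (dualCoeff a))
      = ∑ σ : Equiv.Perm (Fin n),
          polyHom k n (∑ a : TupleB n, mon a * rename σ (dualCoeff a)) * permElt k σ := by
        have h (σ : Equiv.Perm (Fin n)) (a : TupleB n) := permElt_mul_polyHom k σ (dualCoeff a)
        simp only [permElt] at h
        simp only [eElt, Finset.sum_mul, Finset.mul_sum, h, map_sum, map_mul, polyHom_mon,
          permElt, mul_assoc]
        exact Finset.sum_comm
    _ = polyHom k n (discr n) := by
        simp [sum_mon_mul_rename_dualCoeff, apply_ite (polyHom k n), ite_mul, permElt,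
          ← MonoidAlgebra.one_def]

end WeylOldforms

/-- for any `k[G]`-module `M`, the map
`f : ⊕_{a ∈ B} eM → M`, `(m_a)_{a ∈ B} ↦ Σ_{a ∈ B} x_a · m_a`
has kernel and cokernel annihilated by `Δ^{n!}`: every element `(m_a)` of the kernel
satisfies `Δ^{n!}·m_a = 0` for all `a`, and for every `m ∈ M` we have
`Δ^{n!}·m ∈ image(f)`. -/
theorem weylGroupAlgebra_oldforms (k : Type*) [CommRing k] (n : ℕ) (hn : 1 ≤ n)
    (M : Type*) [AddCommGroup M] [Module (MonoidAlgebra k (WeylGrp n)) M] :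
    (∀ m : TupleB n → M, (∀ a, ∃ m', m a = eElt k n • m') →
      ∑ a : TupleB n, xA k a • m a = 0 →
      ∀ a, (DeltaElt k n) ^ (Nat.factorial n) • m a = 0) ∧
    (∀ m : M, ∃ m' : TupleB n → M, (∀ a, ∃ m'', m' a = eElt k n • m'') ∧
      (DeltaElt k n) ^ (Nat.factorial n) • m = ∑ a : TupleB n, xA k a • m' a) := by
  obtain ⟨r, hr⟩ := Nat.exists_eq_succ_of_ne_zero (Nat.factorial_ne_zero n)
  rw [hr]
  constructor
  · intro m hm hsum a
    rw [pow_succ, mul_smul, ← WeylOldforms.polyHom_discr,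
      WeylOldforms.polyHom_discr_smul_eq_zero k _ hsum, smul_zero]
    intro σ b
    obtain ⟨m', hm'⟩ := hm b
    rw [hm', smul_smul, WeylOldforms.permElt_mul_eElt]
  · intro m
    refine ⟨fun a => eElt k n • WeylOldforms.polyHom k n (WeylOldforms.dualCoeff a) •
      DeltaElt k n ^ r • m, fun a => ⟨_, rfl⟩, ?_⟩
    rw [pow_succ', mul_smul, ← WeylOldforms.polyHom_discr k n,
      ← WeylOldforms.sum_xA_mul_eElt_mul_polyHom, Finset.sum_smul]
    simp only [mul_smul]
end

section
/- Let R be a commutative ring and let M be a finitely generated R-module. Regard the product ring R' = ∏_{N ∈ ℕ} R as an R-algebra via the diagonal embedding, suppose we have an R-algebra homomorphism λ : R' → R, and regard R as an R'-algebra via λ. Then the composite map M → ∏_{N ∈ ℕ} M → R ⊗_{R'} ∏_{N ∈ ℕ} M, sending m to 1 ⊗ (m, m, m, …), is surjective. -/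
/-!
STATEMENT 5 (Lemma 4.12 of the paper).  Let `M` be a finitely generated `R`-module,
let `R' = ∏_{N ∈ ℕ} R` with the diagonal `R`-algebra structure, and let `λ : R' → R`
be an `R`-algebra homomorphism.  Then the composite
`M → ∏_N M → R ⊗_{R'} ∏_N M`, `m ↦ 1 ⊗ (m, m, …)` is surjective.
-/

open TensorProduct

/-- A sequence in a finitely generated module is a combination of constant sequences with
coefficients in the product ring. -/
theorem exists_sum_smul_const_eq (ι R M : Type*) [CommRing R] [AddCommGroup M] [Module R M]
    [Module.Finite R M] :
    ∃ (n : ℕ) (s : Fin n → M), ∀ f : ι → M, ∃ c : Fin n → ι → R,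
      f = ∑ i, c i • (fun _ => s i : ι → M) := by
  obtain ⟨n, s, hs⟩ := Module.Finite.exists_fin (R := R) (M := M)
  refine ⟨n, s, fun f => ?_⟩
  have h (k : ι) : ∃ c : Fin n → R, ∑ i, c i • s i = f k :=
    (Submodule.mem_span_range_iff_exists_fun R).1 (hs ▸ Submodule.mem_top)
  choose c hc using h
  refine ⟨fun i k => c k i, funext fun k => ?_⟩
  simp [Finset.sum_apply, ← hc k]

theorem diagonal_tensor_surjective
    (R : Type*) [CommRing R] (M : Type*) [AddCommGroup M] [Module R M]
    [Module.Finite R M]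
    (lam : (∀ _ : ℕ, R) →ₐ[R] R) :
    letI : Algebra (∀ _ : ℕ, R) R := lam.toRingHom.toAlgebra
    Function.Surjective
      (fun m : M =>
        ((1 : R) ⊗ₜ[∀ _ : ℕ, R] (fun _ => m : ∀ _ : ℕ, M) :
          R ⊗[∀ _ : ℕ, R] (∀ _ : ℕ, M))) := by
  let _ : Algebra (∀ _ : ℕ, R) R := lam.toRingHom.toAlgebra
  intro t
  have smul_eq (c : ℕ → R) (r : R) : c • r = lam c * r := rfl
  have hconst (a : R) (m : M) :
      a ⊗ₜ[∀ _ : ℕ, R] (fun _ => m : ℕ → M) = 1 ⊗ₜ[∀ _ : ℕ, R] (fun _ => a • m : ℕ → M) := by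
    have h : (fun _ => a • m : ℕ → M) = (algebraMap R (ℕ → R) a) • (fun _ => m : ℕ → M) := rfl
    rw [h, ← TensorProduct.smul_tmul, smul_eq, lam.commutes, mul_one, Algebra.algebraMap_self,
      RingHom.id_apply]
  induction t with
  | zero => exact ⟨0, TensorProduct.tmul_zero _ _⟩
  | add x y hx hy =>
    obtain ⟨a, rfl⟩ := hx
    obtain ⟨b, rfl⟩ := hy
    exact ⟨a + b, TensorProduct.tmul_add _ _ _⟩
  | tmul r f =>
    obtain ⟨n, s, hs⟩ := exists_sum_smul_const_eq ℕ R M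
    obtain ⟨c, rfl⟩ := hs f
    refine ⟨∑ i, (lam (c i) * r) • s i, ?_⟩
    have h : (fun _ => ∑ i, (lam (c i) * r) • s i : ℕ → M) =
        ∑ i, (fun _ => (lam (c i) * r) • s i : ℕ → M) := by
      ext k
      simp
    simp only [h, TensorProduct.tmul_sum, ← hconst, ← TensorProduct.smul_tmul, smul_eq]
end

section
/- Let (R_N)_{N ∈ ℕ} be a family of commutative rings, let g ≥ 0 be an integer, and for each N let q_N ⊆ R_N be an ideal which can be generated by at most g elements. Then for every integer m ≥ 1 one has the equality of ideals ∏_{N ∈ ℕ} (q_N^m) = (∏_{N ∈ ℕ} q_N)^m in the product ring ∏_{N ∈ ℕ} R_N. -/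
/-!
STATEMENT 7 (abstract form of the first part of Lemma 4.10 of the paper).
For a family of commutative rings `R_N` and ideals `q_N ⊆ R_N`, each generated by
at most `g` elements, one has `∏_N (q_N^m) = (∏_N q_N)^m` inside `∏_N R_N`.
-/

/-- The ideal `∏_N q_N` of the product ring `∏_N R_N`: all sequences `(x_N)` with
`x_N ∈ q_N` for every `N`. -/
def Ideal.piFamily {ι : Type*} {R : ι → Type*} [∀ i, CommRing (R i)]
    (q : ∀ i, Ideal (R i)) : Ideal (∀ i, R i) where
  carrier := {x | ∀ i, x i ∈ q i}
  zero_mem' i := (q i).zero_mem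
  add_mem' ha hb i := (q i).add_mem (ha i) (hb i)
  smul_mem' a _b hb i := (q i).mul_mem_left (a i) (hb i)

namespace Ideal

theorem mem_piFamily {ι : Type*} {R : ι → Type*} [∀ i, CommRing (R i)]
    {q : ∀ i, Ideal (R i)} {x : ∀ i, R i} : x ∈ piFamily q ↔ ∀ i, x i ∈ q i :=
  Iff.rfl

/-- An ideal generated by at most `g` elements is generated by a family indexed by `Fin g`. -/
theorem exists_span_range_fin_eq {A : Type*} [CommRing A] {g : ℕ} {s : Finset A}
    (hs : s.card ≤ g) : ∃ a : Fin g → A, span (Set.range a) = span (s : Set A) := by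
  refine ⟨fun k => s.toList.getD k 0, le_antisymm (span_le.2 ?_) (span_le.2 ?_)⟩
  · rintro _ ⟨k, rfl⟩
    by_cases hk : (k : ℕ) < s.toList.length
    · have hmem : s.toList[(k : ℕ)] ∈ s := Finset.mem_toList.1 (List.getElem_mem hk)
      dsimp only
      rw [List.getD_eq_getElem _ _ hk]
      exact subset_span hmem
    · dsimp only
      rw [List.getD_eq_default _ _ (not_lt.1 hk)]
      exact zero_mem _
  · intro x hx
    obtain ⟨k, hk, rfl⟩ := List.getElem_of_mem (Finset.mem_toList.2 hx)
    have hkg : k < g := lt_of_lt_of_le (by simpa using hk) hs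
    exact subset_span ⟨⟨k, hkg⟩, List.getD_eq_getElem _ _ hk⟩

/-- Products of ideals commute with `piFamily` as soon as the second factors are generated by
families indexed by a common finite type. -/
theorem piFamily_mul {ι κ : Type*} [Finite κ] {R : ι → Type*} [∀ i, CommRing (R i)]
    (I J : ∀ i, Ideal (R i)) (a : ∀ i, κ → R i) (ha : ∀ i, span (Set.range (a i)) = J i) :
    piFamily (fun i => I i * J i) = piFamily I * piFamily J := by
  have := Fintype.ofFinite κ
  refine le_antisymm (fun x hx => ?_) (mul_le.2 fun x hx y hy i => mul_mem_mul (hx i) (hy i))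
  have hsum : ∀ i, ∃ c : κ → R i, (∀ k, c k ∈ I i) ∧ ∑ k, c k * a i k = x i := by
    intro i
    have hxi := mem_piFamily.1 hx i
    rw [← ha i, ← smul_eq_mul, Submodule.mem_ideal_smul_span_iff_exists_sum] at hxi
    obtain ⟨c, hc, hcx⟩ := hxi
    exact ⟨c, hc, by rw [← hcx, Finsupp.sum_fintype _ _ (by simp)]; rfl⟩
  choose c hc hcx using hsum
  have hx_eq : x = ∑ k, (fun i => c i k) * (fun i => a i k) := by
    ext i
    simp [← hcx i]
  rw [hx_eq]
  refine sum_mem _ fun k _ => mul_mem_mul (mem_piFamily.2 fun i => hc i k)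
    (mem_piFamily.2 fun i => ?_)
  exact ha i ▸ subset_span ⟨k, rfl⟩

/-- Powers of ideals commute with `piFamily` for ideals generated by families indexed by a common
finite type. -/
theorem piFamily_pow {ι κ : Type*} [Finite κ] {R : ι → Type*} [∀ i, CommRing (R i)]
    (q : ∀ i, Ideal (R i)) (a : ∀ i, κ → R i) (ha : ∀ i, span (Set.range (a i)) = q i) (m : ℕ) :
    piFamily (fun i => q i ^ m) = piFamily q ^ m := by
  induction m with
  | zero =>
    ext x
    simp [mem_piFamily]
  | succ m ih =>
    simp only [pow_succ]
    rw [piFamily_mul (fun i => q i ^ m) q a ha, ih]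

end Ideal

theorem piFamily_pow_eq_pow_piFamily
    (R : ℕ → Type*) [∀ N, CommRing (R N)] (g : ℕ) (q : ∀ N, Ideal (R N))
    (hq : ∀ N, ∃ s : Finset (R N), s.card ≤ g ∧ Ideal.span (s : Set (R N)) = q N)
    (m : ℕ) (hm : 1 ≤ m) :
    Ideal.piFamily (fun N => q N ^ m) = (Ideal.piFamily q) ^ m := by
  choose s hs hsq using hq
  choose a ha using fun N => Ideal.exists_span_range_fin_eq (hs N)
  exact Ideal.piFamily_pow q a (fun N => (ha N).trans (hsq N)) m
end

section
/- Let E be a field, n ≥ 1, and let h ∈ GL_n(E) be a matrix whose characteristic polynomial has n distinct roots in E. Let V ⊆ M_n(E) be an E-subspace invariant under conjugation by h. Then the following are equivalent: (i) there exists a root α of the characteristic polynomial of h such that tr(e_{h,α}·v) ≠ 0 for some v ∈ V; (ii) V contains a nonzero matrix X with hXh⁻¹ = X; (iii) V is not contained in the image of the linear map M_n(E) → M_n(E), X ↦ hXh⁻¹ − X. -/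
/-!
STATEMENT 10 (key equivalence in the proof of Lemma 2.16 of the paper).
For `h ∈ GL_n(E)` with `n` distinct eigenvalues in `E` and a conjugation-invariant
subspace `V ⊆ M_n(E)`:  (i) `tr(e_{h,α}·v) ≠ 0` for some root `α` and some `v ∈ V`
⟺ (ii) `V` contains a nonzero `h`-invariant matrix ⟺ (iii) `V ⊄ (Ad(h) − 1)M_n(E)`.
-/

open Polynomial

variable {E : Type*} [Field E] {n : ℕ}

/-- `g` has characteristic polynomial with the `n` distinct roots `αs 0, …, αs (n-1)`
in `E` (in particular `g` is regular semisimple). -/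
def HasDistinctEigenvalues (g : Matrix (Fin n) (Fin n) E) (αs : Fin n → E) : Prop :=
  Function.Injective αs ∧ g.charpoly = ∏ i : Fin n, (X - C (αs i))

/-- The `g`-equivariant projection `e_{g,αs i}` onto the `αs i`-eigenspace of `g`:
`e_{g,α} = ∏_{β ≠ α} (α − β)⁻¹ (g − β·1)`, written as a polynomial evaluated at `g`. -/
noncomputable def eigenProjection (g : Matrix (Fin n) (Fin n) E) (αs : Fin n → E)
    (i : Fin n) : Matrix (Fin n) (Fin n) E :=
  Polynomial.aeval g (∏ j ∈ Finset.univ.erase i, (C (αs i - αs j)⁻¹ * (X - C (αs j))))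

/-- The `E`-linear map `M_n(E) → M_n(E)`, `X ↦ hXh⁻¹ − X`, i.e. `Ad(h) − 1`. -/
noncomputable def adSubOne (h : GL (Fin n) E) :
    Matrix (Fin n) (Fin n) E →ₗ[E] Matrix (Fin n) (Fin n) E :=
  (LinearMap.mulRight E ((h⁻¹ : GL (Fin n) E) : Matrix (Fin n) (Fin n) E)).comp
      (LinearMap.mulLeft E ((h : GL (Fin n) E) : Matrix (Fin n) (Fin n) E)) -
    LinearMap.id

/-- A matrix with distinct eigenvalues in the base field is diagonalizable. -/
theorem HasDistinctEigenvalues.exists_mul_eq_mul_diagonal {g : Matrix (Fin n) (Fin n) E}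
    {αs : Fin n → E} (hg : HasDistinctEigenvalues g αs) :
    ∃ P : GL (Fin n) E, g * (P : Matrix (Fin n) (Fin n) E) = P * Matrix.diagonal αs := by
  have hev : ∀ i, Module.End.HasEigenvalue (Matrix.toLin' g) (αs i) := fun i => by
    rw [Module.End.hasEigenvalue_iff_isRoot_charpoly, Matrix.charpoly_toLin', hg.2,
      Polynomial.IsRoot.def, Polynomial.eval_prod]
    exact Finset.prod_eq_zero (Finset.mem_univ i) (by simp)
  choose v hv using fun i => (hev i).exists_hasEigenvector
  have hli : LinearIndependent E v :=
    Module.End.eigenvectors_linearIndependent' (Matrix.toLin' g) αs hg.1 v hv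
  obtain ⟨P, hP⟩ : IsUnit (Matrix.of v).transpose :=
    (Matrix.isUnit_transpose (Matrix.of v)).2 (Matrix.linearIndependent_rows_iff_isUnit.1 hli)
  refine ⟨P, ?_⟩
  rw [hP]
  ext a b
  have := congrFun (hv b).apply_eq_smul a
  rw [Matrix.toLin'_apply] at this
  rw [Matrix.mul_diagonal]
  simpa [Matrix.mul_apply, Matrix.mulVec, dotProduct, mul_comm] using this

theorem Polynomial.aeval_mul_of_mul_eq_mul {R A : Type*} [CommSemiring R] [Semiring A]
    [Algebra R A] {a b c : A} (h : a * c = c * b) (p : R[X]) :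
    aeval a p * c = c * aeval b p := by
  induction p using Polynomial.induction_on' with
  | add p q hp hq => simp [add_mul, mul_add, hp, hq]
  | monomial k r =>
    have hk : a ^ k * c = c * b ^ k := (SemiconjBy.pow_right (x := b) (y := a) h.symm k).symm
    simp only [aeval_monomial]
    rw [mul_assoc, hk, Algebra.left_comm]

theorem Matrix.aeval_diagonal {ι R : Type*} [Fintype ι] [DecidableEq ι] [CommSemiring R]
    (d : ι → R) (p : R[X]) :
    aeval (Matrix.diagonal d) p = Matrix.diagonal fun i => p.eval (d i) := by
  have := Polynomial.aeval_algHom_apply (Matrix.diagonalAlgHom (n := ι) (α := R) R) d p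
  rw [Matrix.diagonalAlgHom_apply] at this
  rw [this, Matrix.diagonalAlgHom_apply]
  congr 1
  ext i
  rw [← Polynomial.coe_aeval_eq_eval]
  exact (Polynomial.aeval_algHom_apply (Pi.evalAlgHom R (fun _ : ι => R) i) d p).symm

theorem eval_eigenProjection_polynomial {αs : Fin n → E} (hα : Function.Injective αs)
    (i k : Fin n) :
    (∏ j ∈ Finset.univ.erase i, (C (αs i - αs j)⁻¹ * (X - C (αs j)))).eval (αs k) =
      (Pi.single i 1 : Fin n → E) k := by
  rw [Polynomial.eval_prod]
  rcases eq_or_ne k i with rfl | hk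
  · rw [Pi.single_eq_same]
    refine Finset.prod_eq_one fun j hj => ?_
    have : αs k - αs j ≠ 0 := sub_ne_zero.2 (hα.ne (Finset.ne_of_mem_erase hj).symm)
    simp [this]
  · rw [Pi.single_eq_of_ne hk]
    exact Finset.prod_eq_zero (Finset.mem_erase.2 ⟨hk, Finset.mem_univ k⟩) (by simp)

/-- In an eigenbasis, pairing with an eigenprojection reads off a diagonal entry. -/
theorem trace_eigenProjection_mul {g : Matrix (Fin n) (Fin n) E} {αs : Fin n → E}
    (hα : Function.Injective αs) {P : GL (Fin n) E}
    (hP : g * (P : Matrix (Fin n) (Fin n) E) = P * Matrix.diagonal αs) (i : Fin n)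
    (v : Matrix (Fin n) (Fin n) E) :
    (eigenProjection g αs i * v).trace =
      ((P⁻¹ : GL (Fin n) E) * v * P : Matrix (Fin n) (Fin n) E) i i := by
  have he : eigenProjection g αs i * P =
      P * Matrix.diagonal (Pi.single i 1 : Fin n → E) := by
    rw [eigenProjection, Polynomial.aeval_mul_of_mul_eq_mul hP, Matrix.aeval_diagonal]
    simp_rw [eval_eigenProjection_polynomial hα]
  have he' : eigenProjection g αs i =
      P * Matrix.diagonal (Pi.single i 1 : Fin n → E) * (P⁻¹ : GL (Fin n) E) := by
    rw [← he, mul_assoc, Units.mul_inv, mul_one]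
  rw [he', mul_assoc, mul_assoc, Matrix.trace_mul_comm, mul_assoc, Matrix.trace]
  simp only [Matrix.diag_apply, Matrix.diagonal_mul]
  rw [Finset.sum_eq_single i (fun j _ hj => by simp [hj]) (by simp)]
  simp

theorem adSubOne_apply (h : GL (Fin n) E) (Z : Matrix (Fin n) (Fin n) E) :
    adSubOne h Z = h * Z * (h⁻¹ : GL (Fin n) E) - Z := rfl

theorem eigenvalue_ne_zero {h P : GL (Fin n) E} {αs : Fin n → E}
    (hP : (h : Matrix (Fin n) (Fin n) E) * P = P * Matrix.diagonal αs) (i : Fin n) :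
    αs i ≠ 0 := by
  have hD : IsUnit (Matrix.diagonal αs) := by
    refine ⟨P⁻¹ * h * P, ?_⟩
    rw [Units.val_mul, Units.val_mul, mul_assoc, hP, Units.inv_mul_cancel_left]
  rw [Matrix.isUnit_diagonal, Pi.isUnit_iff] at hD
  exact (hD i).ne_zero

/-- In an eigenbasis of `h`, the map `Ad(h) − 1` scales each matrix entry. -/
theorem conj_adSubOne_apply_mul {h P : GL (Fin n) E} {αs : Fin n → E}
    (hP : (h : Matrix (Fin n) (Fin n) E) * P = P * Matrix.diagonal αs)
    (Z : Matrix (Fin n) (Fin n) E) (i j : Fin n) :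
    ((P⁻¹ : GL (Fin n) E) * adSubOne h Z * P : Matrix (Fin n) (Fin n) E) i j * αs j =
      (αs i - αs j) * ((P⁻¹ : GL (Fin n) E) * Z * P : Matrix (Fin n) (Fin n) E) i j := by
  have hP' : ((P⁻¹ : GL (Fin n) E) : Matrix (Fin n) (Fin n) E) * h =
      Matrix.diagonal αs * (P⁻¹ : GL (Fin n) E) := by
    rw [← Units.mul_left_inj P, mul_assoc, hP, Units.inv_mul_cancel_left, mul_assoc,
      Units.inv_mul, mul_one]
  have key : ((P⁻¹ : GL (Fin n) E) * adSubOne h Z * P : Matrix (Fin n) (Fin n) E) *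
      Matrix.diagonal αs =
      Matrix.diagonal αs * ((P⁻¹ : GL (Fin n) E) * Z * P) -
        ((P⁻¹ : GL (Fin n) E) * Z * P) * Matrix.diagonal αs := by
    calc _ = (P⁻¹ : GL (Fin n) E) * (adSubOne h Z * h) * P := by
          simp only [mul_assoc, hP]
      _ = (P⁻¹ : GL (Fin n) E) * h * Z * P - (P⁻¹ : GL (Fin n) E) * Z * (h * P) := by
          rw [adSubOne_apply, sub_mul, Units.inv_mul_cancel_right, mul_sub, sub_mul]
          simp only [mul_assoc]
      _ = _ := by
          rw [hP', hP]
          simp only [mul_assoc]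
  have := congrFun (congrFun key i) j
  rw [Matrix.mul_diagonal, Matrix.sub_apply, Matrix.diagonal_mul, Matrix.mul_diagonal] at this
  rw [this]
  ring

/-- In an eigenbasis of `h`, the image of `Ad(h) − 1` consists of the matrices with zero
diagonal. -/
theorem mem_range_adSubOne_iff {h P : GL (Fin n) E} {αs : Fin n → E}
    (hα : Function.Injective αs)
    (hP : (h : Matrix (Fin n) (Fin n) E) * P = P * Matrix.diagonal αs)
    (W : Matrix (Fin n) (Fin n) E) :
    W ∈ LinearMap.range (adSubOne h) ↔
      ∀ i, ((P⁻¹ : GL (Fin n) E) * W * P : Matrix (Fin n) (Fin n) E) i i = 0 := by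
  constructor
  · rintro ⟨Z, rfl⟩ i
    have := conj_adSubOne_apply_mul hP Z i i
    rw [sub_self, zero_mul] at this
    exact (mul_eq_zero.1 this).resolve_right (eigenvalue_ne_zero hP i)
  · intro hW
    let Y : Matrix (Fin n) (Fin n) E := Matrix.of fun i j =>
      ((P⁻¹ : GL (Fin n) E) * W * P : Matrix (Fin n) (Fin n) E) i j * αs j / (αs i - αs j)
    refine ⟨P * Y * (P⁻¹ : GL (Fin n) E), ?_⟩
    have hY : (P⁻¹ : GL (Fin n) E) * (P * Y * (P⁻¹ : GL (Fin n) E)) * P = Y := by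
      simp [mul_assoc]
    rw [← Units.mul_right_inj P⁻¹, ← Units.mul_left_inj P]
    ext i j
    refine mul_right_cancel₀ (eigenvalue_ne_zero hP j) ?_
    rw [conj_adSubOne_apply_mul hP, hY]
    rcases eq_or_ne i j with rfl | hij
    · rw [hW, sub_self, zero_mul, zero_mul]
    · exact mul_div_cancel₀ _ (sub_ne_zero.2 (hα.ne hij))

/-- `Ad(h) − 1` has trivial kernel on its image. -/
theorem disjoint_ker_range_adSubOne {h P : GL (Fin n) E} {αs : Fin n → E}
    (hα : Function.Injective αs)
    (hP : (h : Matrix (Fin n) (Fin n) E) * P = P * Matrix.diagonal αs) :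
    Disjoint (LinearMap.ker (adSubOne h)) (LinearMap.range (adSubOne h)) := by
  rw [Submodule.disjoint_def]
  intro Z hk hr
  rw [mem_range_adSubOne_iff hα hP] at hr
  rw [← Units.mul_right_inj P⁻¹, ← Units.mul_left_inj P, mul_zero, zero_mul]
  ext i j
  rcases eq_or_ne i j with rfl | hij
  · exact hr i
  · have := conj_adSubOne_apply_mul hP Z i j
    rw [LinearMap.mem_ker.1 hk, mul_zero, zero_mul, Matrix.zero_apply, zero_mul] at this
    exact (mul_eq_zero.1 this.symm).resolve_left (sub_ne_zero.2 (hα.ne hij))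

/-- A finite-dimensional invariant subspace on which `f` is injective lies in the range of `f`. -/
theorem Submodule.le_range_of_disjoint_ker {K M : Type*} [Field K] [AddCommGroup M] [Module K M]
    {f : M →ₗ[K] M} {V : Submodule K M} [FiniteDimensional K V] (hV : ∀ v ∈ V, f v ∈ V)
    (hd : Disjoint V (LinearMap.ker f)) : V ≤ LinearMap.range f := by
  have hinj : Function.Injective (f.restrict hV) := by
    rw [← LinearMap.ker_eq_bot, LinearMap.ker_eq_bot']
    intro v hv
    exact Subtype.ext (Submodule.disjoint_def.1 hd v v.2 (congrArg Subtype.val hv))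
  intro v hv
  obtain ⟨w, hw⟩ := LinearMap.surjective_of_injective hinj ⟨v, hv⟩
  exact ⟨w, congrArg Subtype.val hw⟩

theorem eigenProjection_trace_tfae (hn : 1 ≤ n) (h : GL (Fin n) E) (αs : Fin n → E)
    (hreg : HasDistinctEigenvalues (h : Matrix (Fin n) (Fin n) E) αs)
    (V : Submodule E (Matrix (Fin n) (Fin n) E))
    (hV : ∀ v ∈ V, (h : Matrix (Fin n) (Fin n) E) * v *
      ((h⁻¹ : GL (Fin n) E) : Matrix (Fin n) (Fin n) E) ∈ V) :
    ((∃ i : Fin n, ∃ v ∈ V,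
        Matrix.trace (eigenProjection (h : Matrix (Fin n) (Fin n) E) αs i * v) ≠ 0) ↔
      (∃ X ∈ V, X ≠ 0 ∧ (h : Matrix (Fin n) (Fin n) E) * X *
        ((h⁻¹ : GL (Fin n) E) : Matrix (Fin n) (Fin n) E) = X)) ∧
    ((∃ X ∈ V, X ≠ 0 ∧ (h : Matrix (Fin n) (Fin n) E) * X *
        ((h⁻¹ : GL (Fin n) E) : Matrix (Fin n) (Fin n) E) = X) ↔
      ¬ (V ≤ LinearMap.range (adSubOne h))) := by
  obtain ⟨P, hP⟩ := hreg.exists_mul_eq_mul_diagonal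
  have hker : ∀ Z : Matrix (Fin n) (Fin n) E,
      (h : Matrix (Fin n) (Fin n) E) * Z * (h⁻¹ : GL (Fin n) E) = Z ↔
        Z ∈ LinearMap.ker (adSubOne h) := fun Z => by
    rw [LinearMap.mem_ker, adSubOne_apply, sub_eq_zero]
  have trace_iff : (∃ i : Fin n, ∃ v ∈ V,
      Matrix.trace (eigenProjection (h : Matrix (Fin n) (Fin n) E) αs i * v) ≠ 0) ↔
      ¬ (V ≤ LinearMap.range (adSubOne h)) := by
    simp only [SetLike.le_def, mem_range_adSubOne_iff hreg.1 hP,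
      trace_eigenProjection_mul hreg.1 hP]
    push Not
    exact ⟨fun ⟨i, v, hv, hi⟩ => ⟨v, hv, i, hi⟩, fun ⟨v, hv, i, hi⟩ => ⟨i, v, hv, hi⟩⟩
  have fixed_iff : (∃ X ∈ V, X ≠ 0 ∧ (h : Matrix (Fin n) (Fin n) E) * X *
        ((h⁻¹ : GL (Fin n) E) : Matrix (Fin n) (Fin n) E) = X) ↔
      ¬ (V ≤ LinearMap.range (adSubOne h)) := by
    simp only [hker]
    constructor
    · rintro ⟨Z, hZV, hZ0, hZ⟩ hle
      exact hZ0 (Submodule.disjoint_def.1 (disjoint_ker_range_adSubOne hreg.1 hP) Z hZ (hle hZV))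
    · contrapose!
      intro hno
      refine Submodule.le_range_of_disjoint_ker (fun v hv => V.sub_mem (hV v hv) hv) ?_
      rw [Submodule.disjoint_def]
      exact fun Z hZV hZ => by_contra fun hZ0 => hno Z hZV hZ0 hZ
  exact ⟨trace_iff.trans fixed_iff.symm, fixed_iff⟩
end

section
/- Let 𝒪 be a local ring with maximal ideal 𝔪, let R = ∏_{N ∈ ℕ} 𝒪 be the product ring, and let 𝓕 be a non-principal ultrafilter on ℕ. For I ∈ 𝓕 let e_I ∈ R be the idempotent with (e_I)_N = 1 if N ∈ I and (e_I)_N = 0 otherwise, and let S = {e_I : I ∈ 𝓕}, a multiplicative subset of R. Then: (a) the localization map R → S⁻¹R is surjective; (b) the set 𝔭 = {(x_N) ∈ R : {N : x_N ∈ 𝔪} ∈ 𝓕} is a prime ideal of R, and S⁻¹R is the localization of R at the prime ideal 𝔭 (that is, S⁻¹R, with its natural R-algebra structure, satisfies the universal property of the localization of R at the multiplicative set R \ 𝔭). -/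
/-!
STATEMENT 15.  `𝒪` a local ring, `R = ∏_{N ∈ ℕ} 𝒪`, `𝓕` a non-principal
ultrafilter on `ℕ`, `S = {e_I : I ∈ 𝓕}` the multiplicative set of the associated
idempotents.  Then the localization map `R → S⁻¹R` is surjective, the set
`𝔭 = {(x_N) : {N : x_N ∈ 𝔪} ∈ 𝓕}` is a prime ideal of `R`, and `S⁻¹R` is the
localization of `R` at `𝔭`.
-/

section Defs

variable (𝒪 : Type*) [CommRing 𝒪]

/-- The multiplicative set `S = {e_I : I ∈ 𝓕} ⊆ ∏_N 𝒪`, where `e_I` is the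
idempotent which is `1` on `I` and `0` off `I`. -/
def idemSubmonoid (𝓕 : Ultrafilter ℕ) : Submonoid (∀ _ : ℕ, 𝒪) where
  carrier := {x | ∃ I ∈ 𝓕, x = Set.indicator I (fun _ => (1 : 𝒪))}
  one_mem' := ⟨Set.univ, Filter.univ_mem, by funext N; simp⟩
  mul_mem' := by
    rintro x y ⟨I, hI, rfl⟩ ⟨J, hJ, rfl⟩
    refine ⟨I ∩ J, Filter.inter_mem hI hJ, ?_⟩
    funext N
    by_cases hNI : N ∈ I <;> by_cases hNJ : N ∈ J <;>
      simp [Set.indicator_apply, hNI, hNJ]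

variable [IsLocalRing 𝒪]

/-- The set `𝔭 = {(x_N) ∈ ∏_N 𝒪 : {N : x_N ∈ 𝔪} ∈ 𝓕}`, as an ideal of `∏_N 𝒪`. -/
def ultraIdeal (𝓕 : Ultrafilter ℕ) : Ideal (∀ _ : ℕ, 𝒪) where
  carrier := {x | {N | x N ∈ IsLocalRing.maximalIdeal 𝒪} ∈ 𝓕}
  zero_mem' := Filter.univ_mem' fun N => (IsLocalRing.maximalIdeal 𝒪).zero_mem
  add_mem' := by
    intro a b ha hb
    exact Filter.mem_of_superset (Filter.inter_mem ha hb)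
      (fun N hN => (IsLocalRing.maximalIdeal 𝒪).add_mem hN.1 hN.2)
  smul_mem' := by
    intro c x hx
    exact Filter.mem_of_superset hx
      (fun N hN => (IsLocalRing.maximalIdeal 𝒪).mul_mem_left (c N) hN)

end Defs

/-- Localizing at a multiplicative set of idempotents is surjective: the idempotents become
idempotent units, that is, `1`. -/
theorem IsLocalization.algebraMap_surjective_of_forall_isIdempotentElem
    {R : Type*} [CommRing R] (M : Submonoid R) (A : Type*) [CommRing A] [Algebra R A]
    [IsLocalization M A] (hM : ∀ m ∈ M, IsIdempotentElem m) :
    Function.Surjective (algebraMap R A) := by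
  intro z
  obtain ⟨⟨r, s⟩, hz⟩ := IsLocalization.surj M z
  have hs : algebraMap R A s = 1 :=
    (IsLocalization.map_units A s).mul_left_cancel <| by
      rw [← map_mul, (hM s s.2).eq, mul_one]
  exact ⟨r, by simpa [hs] using hz.symm⟩

theorem isIdempotentElem_of_mem_idemSubmonoid {𝒪 : Type*} [CommRing 𝒪] {𝓕 : Ultrafilter ℕ}
    {x : ∀ _ : ℕ, 𝒪} (hx : x ∈ idemSubmonoid 𝒪 𝓕) : IsIdempotentElem x := by
  obtain ⟨I, -, rfl⟩ := hx
  funext N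
  by_cases hN : N ∈ I <;> simp [hN]

section UltraIdeal

variable {𝒪 : Type*} [CommRing 𝒪] [IsLocalRing 𝒪] {𝓕 : Ultrafilter ℕ}

theorem mem_ultraIdeal {x : ∀ _ : ℕ, 𝒪} :
    x ∈ ultraIdeal 𝒪 𝓕 ↔ ∀ᶠ N in 𝓕, x N ∈ IsLocalRing.maximalIdeal 𝒪 :=
  Iff.rfl

theorem notMem_ultraIdeal {x : ∀ _ : ℕ, 𝒪} :
    x ∉ ultraIdeal 𝒪 𝓕 ↔ ∀ᶠ N in 𝓕, IsUnit (x N) := by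
  rw [mem_ultraIdeal, ← Ultrafilter.eventually_not]
  simp

theorem isPrime_ultraIdeal : (ultraIdeal 𝒪 𝓕).IsPrime := by
  refine ⟨(Ideal.ne_top_iff_one _).2 (notMem_ultraIdeal.2 (by simp)), fun {x y} hxy => ?_⟩
  contrapose! hxy
  rw [notMem_ultraIdeal, notMem_ultraIdeal] at hxy
  rw [notMem_ultraIdeal]
  filter_upwards [hxy.1, hxy.2] with N hx hy using hx.mul hy

theorem notMem_ultraIdeal_of_mem_idemSubmonoid {x : ∀ _ : ℕ, 𝒪}
    (hx : x ∈ idemSubmonoid 𝒪 𝓕) : x ∉ ultraIdeal 𝒪 𝓕 := by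
  obtain ⟨I, hI, rfl⟩ := hx
  rw [notMem_ultraIdeal]
  filter_upwards [hI] with N hN
  simp [hN]

theorem exists_mem_idemSubmonoid_dvd {x : ∀ _ : ℕ, 𝒪} (hx : x ∉ ultraIdeal 𝒪 𝓕) :
    ∃ e ∈ idemSubmonoid 𝒪 𝓕, x ∣ e := by
  refine ⟨_, ⟨{N | IsUnit (x N)}, notMem_ultraIdeal.1 hx, rfl⟩,
    fun N => Ring.inverse (x N), ?_⟩
  funext N
  by_cases hN : IsUnit (x N)
  · simp [hN, Ring.mul_inverse_cancel]
  · simp [hN, Ring.inverse_non_unit]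

end UltraIdeal

theorem localization_at_idempotents_eq_localization_at_ultraIdeal
    (𝒪 : Type*) [CommRing 𝒪] [IsLocalRing 𝒪]
    (𝓕 : Ultrafilter ℕ) (h𝓕 : ∀ a : ℕ, (𝓕 : Filter ℕ) ≠ pure a) :
    -- (a) the localization map R → S⁻¹R is surjective
    Function.Surjective
      (algebraMap (∀ _ : ℕ, 𝒪) (Localization (idemSubmonoid 𝒪 𝓕))) ∧
    -- (b) 𝔭 is a prime ideal and S⁻¹R is the localization of R at 𝔭
    ∃ hp : (ultraIdeal 𝒪 𝓕).IsPrime,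
      @IsLocalization _ _ (@Ideal.primeCompl _ _ (ultraIdeal 𝒪 𝓕) hp)
        (Localization (idemSubmonoid 𝒪 𝓕)) _ _ := by
  refine ⟨IsLocalization.algebraMap_surjective_of_forall_isIdempotentElem (idemSubmonoid 𝒪 𝓕) _
    fun _ => isIdempotentElem_of_mem_idemSubmonoid, isPrime_ultraIdeal, ?_⟩
  have := isPrime_ultraIdeal (𝒪 := 𝒪) (𝓕 := 𝓕)
  exact IsLocalization.of_le_of_exists_dvd (idemSubmonoid 𝒪 𝓕) (ultraIdeal 𝒪 𝓕).primeCompl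
    (fun _ => notMem_ultraIdeal_of_mem_idemSubmonoid) (fun _ => exists_mem_idemSubmonoid_dvd)
end
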